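/- Let A have Jordan form ⊕_{i=1}^N J_{p_i}(λ_i) and B have Jordan form ⊕_{j=1}^M J_{r_j}(μ_j) in M_n(ℂ), and let Δ(T) = ATB − T on M_n(ℂ). Then rd_k(im Δ) = Σ_{i,j} R(i,j,k), where R(i,j,k) = min{p_i, r_j} − k if λ_i ≠ 0, μ_j ≠ 0, λ_i = 1/μ_j and k < min{p_i, r_j}, and R(i,j,k) = 0 otherwise. -/

import Mathlib

open Matrix

/-- The trace-pairing annihilator of a set of matrices. -/
def annih {α β : Type*} [Fintype α] [Fintype β] (S : Set (Matrix α β ℂ)) :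
    Set (Matrix β α ℂ) := {C | ∀ A ∈ S, (C * A).trace = 0}

/-- The algebraic `k`-reflexive cover `(S_⊥ ∩ F_k)_⊥`. -/
noncomputable def RefK {α β : Type*} [Fintype α] [Fintype β] (k : ℕ)
    (S : Set (Matrix α β ℂ)) : Set (Matrix α β ℂ) :=
  annih {C | C ∈ annih S ∧ C.rank ≤ k}

/-- The `k`-reflexivity defect. -/
noncomputable def rdK {α β : Type*} [Fintype α] [Fintype β] (k : ℕ)
    (S : Set (Matrix α β ℂ)) : ℕ :=
  Module.finrank ℂ (Submodule.span ℂ (RefK k S)) -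
    Module.finrank ℂ (Submodule.span ℂ S)

/-- The `m × m` Jordan block with eigenvalue `lam`. -/
def JB (m : ℕ) (lam : ℂ) : Matrix (Fin m) (Fin m) ℂ :=
  Matrix.of fun i j => if (j : ℕ) = (i : ℕ) + 1 then 1 else if j = i then lam else 0

/-- Upper triangular Toeplitz matrices: entry `(i,j)` depends only on `j - i`,
and vanishes when `j < i`. -/
def UTToeplitz (m : ℕ) : Set (Matrix (Fin m) (Fin m) ℂ) :=
  {C | (∀ i j : Fin m, (j : ℕ) < (i : ℕ) → C i j = 0) ∧
    ∀ i j i' j' : Fin m, (i : ℕ) + (j' : ℕ) = (i' : ℕ) + (j : ℕ) → C i j = C i' j'}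

/-- If `g` is nilpotent on `w` and `g ^ k` does not kill `w`, then `w, g w, …, g ^ k w` are
linearly independent. -/
lemma linearIndependent_pow_apply {K V : Type*} [Field K] [AddCommGroup V] [Module K V]
    (g : Module.End K V) (w : V) (k : ℕ) (hk : (g ^ k) w ≠ 0) (hnil : ∃ m, (g ^ m) w = 0) :
    LinearIndependent K fun j : Fin (k + 1) => (g ^ (j : ℕ)) w := by
  classical
  have hge : ∀ m, (g ^ m) w = 0 → ∀ l, m ≤ l → (g ^ l) w = 0 := by
    intro m hm l hl
    obtain ⟨d, rfl⟩ := Nat.exists_eq_add_of_le' hl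
    rw [pow_add, Module.End.mul_apply, hm, map_zero]
  set m := Nat.find hnil with hmdef
  have hm : (g ^ m) w = 0 := Nat.find_spec hnil
  have hkm : k < m := by
    by_contra h
    exact hk (hge m hm k (by omega))
  have hm1 : (g ^ (m - 1)) w ≠ 0 := Nat.find_min hnil (by omega)
  rw [Fintype.linearIndependent_iff]
  intro c hc
  have key : ∀ j : ℕ, ∀ hj : j < k + 1, c ⟨j, hj⟩ = 0 := by
    intro j
    induction j using Nat.strong_induction_on with
    | _ j ih =>
      intro hj
      have h := congrArg (g ^ (m - 1 - j)) hc
      rw [map_sum, map_zero, Finset.sum_eq_single ⟨j, hj⟩] at h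
      · rw [map_smul, ← Module.End.mul_apply, ← pow_add] at h
        have e : m - 1 - j + j = m - 1 := by omega
        simp only [e] at h
        exact (smul_eq_zero.mp h).resolve_right hm1
      · rintro ⟨i, hi⟩ - hij
        rcases lt_or_gt_of_ne (fun h : i = j => hij (Fin.ext h)) with h' | h'
        · rw [ih i h' hi, zero_smul, map_zero]
        · rw [map_smul, ← Module.End.mul_apply, ← pow_add,
            hge m hm _ (by simp only; omega), smul_zero]
      · simp
  exact fun i => key i i.2

lemma intertwines_pow_apply {K V W : Type*} [Field K] [AddCommGroup V] [Module K V]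
    [AddCommGroup W] [Module K W] (f : Module.End K V) (g : Module.End K W)
    (X : V →ₗ[K] W) (hX : g ∘ₗ X = X ∘ₗ f) (j : ℕ) (v : V) :
    X ((f ^ j) v) = (g ^ j) (X v) := by
  induction j with
  | zero => simp
  | succ j ih =>
    rw [pow_succ', pow_succ', Module.End.mul_apply, Module.End.mul_apply, ← ih]
    exact (LinearMap.congr_fun hX _).symm

/-- Intertwiners `X` from a cyclic nilpotent endomorphism `f` with cyclic vector `v` to `g`
have rank at most `k` exactly when `g ^ k` kills `X v`. -/
lemma finrank_range_le_iff_of_intertwines {K V W : Type*} [Field K] [AddCommGroup V] [Module K V]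
    [AddCommGroup W] [Module K W] [FiniteDimensional K W] (f : Module.End K V)
    (g : Module.End K W) (v : V) (p : ℕ)
    (b : Module.Basis (Fin p) K V) (hb : ∀ j, b j = (f ^ (j : ℕ)) v) (hf : f ^ p = 0)
    (X : V →ₗ[K] W) (hX : g ∘ₗ X = X ∘ₗ f) (k : ℕ) :
    Module.finrank K (LinearMap.range X) ≤ k ↔ (g ^ k) (X v) = 0 := by
  have hpow := fun j => intertwines_pow_apply f g X hX j v
  constructor
  · intro h
    by_contra hk
    have li := linearIndependent_pow_apply g (X v) k hk ⟨p, by rw [← hpow, hf]; simp⟩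
    have hmem : ∀ j : Fin (k + 1), (g ^ (j : ℕ)) (X v) ∈ LinearMap.range X :=
      fun j => ⟨(f ^ (j : ℕ)) v, hpow j⟩
    have li' : LinearIndependent K
        fun j : Fin (k + 1) => (⟨(g ^ (j : ℕ)) (X v), hmem j⟩ : LinearMap.range X) :=
      LinearIndependent.of_comp (LinearMap.range X).subtype li
    have := li'.fintype_card_le_finrank
    rw [Fintype.card_fin] at this
    omega
  · intro h
    have hle : LinearMap.range X ≤
        Submodule.span K (Set.range fun j : Fin k => (g ^ (j : ℕ)) (X v)) := by
      rw [LinearMap.range_eq_map, ← b.span_eq, Submodule.map_span, Submodule.span_le]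
      rintro _ ⟨_, ⟨j, rfl⟩, rfl⟩
      rw [hb, hpow]
      by_cases hj : (j : ℕ) < k
      · exact Submodule.subset_span ⟨⟨j, hj⟩, rfl⟩
      · obtain ⟨d, hd⟩ := Nat.exists_eq_add_of_le' (not_lt.mp hj)
        rw [hd, pow_add, Module.End.mul_apply, h, map_zero]
        exact Submodule.zero_mem _
    refine (Submodule.finrank_mono hle).trans ?_
    exact (finrank_range_le_card _).trans (by simp)

/-- Every vector of `ker (g ^ p)` is the image of the cyclic vector under an intertwiner. -/
lemma exists_intertwiner_of_pow_apply_eq_zero {K V W : Type*} [Field K] [AddCommGroup V]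
    [Module K V] [AddCommGroup W] [Module K W] (f : Module.End K V)
    (g : Module.End K W) (v : V) (p : ℕ)
    (b : Module.Basis (Fin p) K V) (hb : ∀ j, b j = (f ^ (j : ℕ)) v) (hf : f ^ p = 0)
    (w : W) (hw : (g ^ p) w = 0) :
    ∃ X : V →ₗ[K] W, g ∘ₗ X = X ∘ₗ f ∧ X v = w := by
  have hXb : ∀ j : ℕ, (b.constr K fun j : Fin p => (g ^ (j : ℕ)) w) ((f ^ j) v) = (g ^ j) w := by
    intro j
    by_cases hj : j < p
    · have := hb ⟨j, hj⟩
      simp only at this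
      rw [← this, b.constr_basis]
    · obtain ⟨d, rfl⟩ := Nat.exists_eq_add_of_le' (not_lt.mp hj)
      rw [pow_add, pow_add, hf, Module.End.mul_apply (g ^ d), hw]
      simp
  refine ⟨b.constr K fun j : Fin p => (g ^ (j : ℕ)) w, ?_, by simpa using hXb 0⟩
  apply b.ext
  intro j
  rw [LinearMap.comp_apply, LinearMap.comp_apply, hb, hXb, ← Module.End.mul_apply f,
    ← pow_succ', hXb, pow_succ', Module.End.mul_apply]

/-- An intertwiner vanishing at the cyclic vector is zero. -/
lemma eq_zero_of_intertwines_of_apply_eq_zero {K V W : Type*} [Field K] [AddCommGroup V]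
    [Module K V] [AddCommGroup W] [Module K W] (f : Module.End K V)
    (g : Module.End K W) (v : V) (p : ℕ)
    (b : Module.Basis (Fin p) K V) (hb : ∀ j, b j = (f ^ (j : ℕ)) v)
    (X : V →ₗ[K] W) (hX : g ∘ₗ X = X ∘ₗ f) (hv : X v = 0) : X = 0 := by
  apply b.ext
  intro j
  rw [hb]
  rw [intertwines_pow_apply f g X hX, hv, map_zero, LinearMap.zero_apply]

lemma JB_eq_smul_one_add (m : ℕ) (lam : ℂ) : JB m lam = lam • 1 + JB m 0 := by
  ext i j
  simp only [JB, Matrix.of_apply, Matrix.add_apply, Matrix.smul_apply, Matrix.one_apply,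
    smul_eq_mul]
  by_cases h : j = i
  · subst h; simp
  · simp [h, Ne.symm h]

lemma isUnit_JB (m : ℕ) {lam : ℂ} (h : lam ≠ 0) : IsUnit (JB m lam) := by
  rw [Matrix.isUnit_iff_isUnit_det, Matrix.det_of_isUpperTriangular]
  · simp [JB, isUnit_iff_ne_zero, h]
  · intro i j hij
    have hij' : (j : ℕ) < i := hij
    have h1 : j ≠ i := fun e => by subst e; omega
    simp only [JB, Matrix.of_apply]
    rw [if_neg (by omega), if_neg h1]

lemma JB_zero_mulVec (m : ℕ) (w : Fin m → ℂ) (a : Fin m) :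
    (JB m 0 *ᵥ w) a = if h : (a : ℕ) + 1 < m then w ⟨a + 1, h⟩ else 0 := by
  simp only [Matrix.mulVec, dotProduct, JB, Matrix.of_apply, ite_self]
  split_ifs with h
  · rw [Finset.sum_eq_single ⟨a + 1, h⟩]
    · simp
    · intro b _ hb
      rw [if_neg (fun e => hb (Fin.ext e)), zero_mul]
    · simp
  · refine Finset.sum_eq_zero fun b _ => ?_
    rw [if_neg (by omega), zero_mul]

lemma toLin'_JB_zero_pow_apply (m : ℕ) (w : Fin m → ℂ) (s : ℕ) (a : Fin m) :
    ((Matrix.toLin' (JB m 0)) ^ s) w a = if h : (a : ℕ) + s < m then w ⟨a + s, h⟩ else 0 := by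
  induction s generalizing a with
  | zero => simp
  | succ s ih =>
    rw [pow_succ', Module.End.mul_apply, Matrix.toLin'_apply, JB_zero_mulVec]
    by_cases h : (a : ℕ) + 1 < m
    · rw [dif_pos h, ih]
      simp only [add_assoc, add_comm 1 s]
    · rw [dif_neg h, dif_neg (by omega)]

lemma toLin'_JB_zero_pow_eq_zero_iff (m s : ℕ) (w : Fin m → ℂ) :
    ((Matrix.toLin' (JB m 0)) ^ s) w = 0 ↔ ∀ a : Fin m, s ≤ a → w a = 0 := by
  constructor
  · intro h a ha
    have := congrFun h ⟨a - s, by omega⟩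
    rw [toLin'_JB_zero_pow_apply, dif_pos (by simp only; omega)] at this
    simpa [Nat.sub_add_cancel ha] using this
  · intro h
    ext a
    rw [toLin'_JB_zero_pow_apply]
    split_ifs with h'
    · exact h _ (by simp)
    · rfl

lemma finrank_ker_toLin'_JB_zero_pow (m s : ℕ) :
    Module.finrank ℂ (LinearMap.ker ((Matrix.toLin' (JB m 0)) ^ s)) = min m s := by
  have hker : LinearMap.ker ((Matrix.toLin' (JB m 0)) ^ s) =
      LinearMap.ker (LinearMap.funLeft ℂ ℂ (Subtype.val : {a : Fin m // ¬ (a : ℕ) < s} → Fin m)) := by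
    ext w
    rw [LinearMap.mem_ker, LinearMap.mem_ker, toLin'_JB_zero_pow_eq_zero_iff]
    constructor
    · intro h
      ext ⟨a, ha⟩
      exact h a (not_lt.mp ha)
    · intro h a ha
      exact congrFun h ⟨a, not_lt.mpr ha⟩
  have h := LinearMap.finrank_range_add_finrank_ker
    (LinearMap.funLeft ℂ ℂ (Subtype.val : {a : Fin m // ¬ (a : ℕ) < s} → Fin m))
  rw [LinearMap.range_eq_top.mpr (LinearMap.funLeft_surjective_of_injective _ _ _
    Subtype.val_injective), finrank_top, ← hker, Module.finrank_fintype_fun_eq_card,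
    Module.finrank_fintype_fun_eq_card, Fintype.card_fin, Fintype.card_subtype_compl,
    Fintype.card_fin, Fintype.card_subtype, Fin.card_filter_val_lt] at h
  omega

/-- For `lam ≠ 0` the nilpotent part of `(JB p lam)⁻¹` is cyclic. -/
lemma exists_cyclic_basis_inv_JB (p : ℕ) {lam mu : ℂ} (h : lam * mu = 1) :
    ∃ (v : Fin p → ℂ) (b : Module.Basis (Fin p) ℂ (Fin p → ℂ)),
      (∀ j, b j = ((Matrix.toLin' ((JB p lam)⁻¹ - mu • 1)) ^ (j : ℕ)) v) ∧
      (Matrix.toLin' ((JB p lam)⁻¹ - mu • 1)) ^ p = 0 := by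
  have hlam : lam ≠ 0 := left_ne_zero_of_mul_eq_one h
  have hmu : mu ≠ 0 := right_ne_zero_of_mul_eq_one h
  set U := JB p lam with hU
  set N := JB p 0 with hN
  have hUu : IsUnit U.det := (Matrix.isUnit_iff_isUnit_det _).mp (isUnit_JB p hlam)
  have hUN : U = lam • 1 + N := JB_eq_smul_one_add p lam
  have hcomm : Commute U N := by
    rw [hUN]
    exact ((Commute.one_left N).smul_left lam).add_left (Commute.refl N)
  have hcomm' : Commute ((-mu) • U⁻¹) N := by
    refine Commute.smul_left ?_ _
    have h1 : U⁻¹ * (U * N) * U⁻¹ = U⁻¹ * (N * U) * U⁻¹ := by rw [hcomm.eq]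
    rw [← Matrix.mul_assoc, Matrix.nonsing_inv_mul _ hUu, Matrix.one_mul, Matrix.mul_assoc,
      Matrix.mul_assoc, Matrix.mul_nonsing_inv _ hUu, Matrix.mul_one] at h1
    exact h1.symm
  have hf : U⁻¹ - mu • 1 = ((-mu) • U⁻¹) * N := by
    have hN' : N = U - lam • 1 := by rw [hUN]; simp
    rw [hN', Matrix.mul_sub, Matrix.smul_mul, Matrix.nonsing_inv_mul _ hUu, Matrix.mul_smul,
      Matrix.mul_one, smul_smul, mul_neg, h]
    simp only [neg_smul, one_smul]
    abel
  have hunit : IsUnit ((-mu) • U⁻¹) := by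
    have : IsUnit U⁻¹ := by
      rw [Matrix.isUnit_nonsing_inv_iff]
      exact isUnit_JB p hlam
    exact this.smul (Units.mk0 (-mu) (neg_ne_zero.mpr hmu))
  have hpow : ∀ j w, ((Matrix.toLin' (U⁻¹ - mu • 1)) ^ j) w = 0 ↔
      ((Matrix.toLin' N) ^ j) w = 0 := by
    intro j w
    rw [hf, ← Matrix.toLin'_pow, ← Matrix.toLin'_pow, hcomm'.mul_pow, Matrix.toLin'_mul,
      LinearMap.comp_apply]
    have hinj := Matrix.mulVec_injective_of_isUnit (hunit.pow j)
    constructor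
    · intro h0
      exact hinj (h0.trans (Matrix.mulVec_zero _).symm)
    · intro h0
      rw [h0, map_zero]
  have hnil : (Matrix.toLin' (U⁻¹ - mu • 1)) ^ p = 0 := by
    ext1 w
    ext1
    simp only [LinearMap.comp_apply, LinearMap.zero_comp, LinearMap.zero_apply]
    rw [(hpow p _).mpr]
    exact (toLin'_JB_zero_pow_eq_zero_iff p p _).mpr fun a ha => absurd a.2 (by omega)
  set f := Matrix.toLin' (U⁻¹ - mu • 1) with hfdef
  cases p with
  | zero =>
    exact ⟨0, Pi.basisFun ℂ (Fin 0), fun j => j.elim0, hnil⟩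
  | succ q =>
    have hv : (f ^ q) (Pi.single (Fin.last q) 1) ≠ 0 := by
      rw [Ne, hpow, toLin'_JB_zero_pow_eq_zero_iff]
      intro h0
      have := h0 (Fin.last q) (by simp)
      simp at this
    have li := linearIndependent_pow_apply f (Pi.single (Fin.last q) 1) q hv
      ⟨q + 1, by rw [hnil]; rfl⟩
    refine ⟨Pi.single (Fin.last q) 1,
      basisOfLinearIndependentOfCardEqFinrank li (by simp), fun j => ?_, hnil⟩
    rw [coe_basisOfLinearIndependentOfCardEqFinrank]

/-- The solution space of `B X A = X`. -/
def sandwichFixed {m n : Type*} [Fintype m] [Fintype n] (B : Matrix m m ℂ) (A : Matrix n n ℂ) :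
    Submodule ℂ (Matrix m n ℂ) where
  carrier := {X | B * X * A = X}
  add_mem' := by
    intro X Y hX hY
    simp only [Set.mem_ofPred_eq] at *
    rw [Matrix.mul_add, Matrix.add_mul, hX, hY]
  zero_mem' := by simp
  smul_mem' := by
    intro c X hX
    simp only [Set.mem_ofPred_eq] at *
    rw [Matrix.mul_smul, Matrix.smul_mul, hX]

@[simp]
lemma mem_sandwichFixed {m n : Type*} [Fintype m] [Fintype n] {B : Matrix m m ℂ}
    {A : Matrix n n ℂ} {X : Matrix m n ℂ} : X ∈ sandwichFixed B A ↔ B * X * A = X := Iff.rfl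

lemma sandwichFixed_JB_eq_bot (p r : ℕ) {lam mu : ℂ} (h : lam * mu ≠ 1) :
    sandwichFixed (JB r mu) (JB p lam) = ⊥ := by
  rw [eq_bot_iff]
  intro X hX
  rw [mem_sandwichFixed, JB_eq_smul_one_add r, JB_eq_smul_one_add p] at hX
  have hl : ∀ (Y : Matrix (Fin r) (Fin p) ℂ) a b, (JB r 0 * Y) a b =
      if h : (a : ℕ) + 1 < r then Y ⟨a + 1, h⟩ b else 0 := fun Y a b =>
    JB_zero_mulVec r (fun a => Y a b) a
  have hr : ∀ (Y : Matrix (Fin r) (Fin p) ℂ) a (b : Fin p), (∀ b' : Fin p, b' < b → Y a b' = 0) →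
      (Y * JB p 0) a b = 0 := by
    intro Y a b hb
    rw [Matrix.mul_apply]
    refine Finset.sum_eq_zero fun b' _ => ?_
    simp only [JB, Matrix.of_apply, ite_self]
    split_ifs with h'
    · rw [hb b' (Fin.lt_def.mpr (by omega)), zero_mul]
    · rw [mul_zero]
  have key : ∀ s : ℕ, ∀ (a : Fin r) (b : Fin p), r - 1 - (a : ℕ) + (b : ℕ) = s → X a b = 0 := by
    intro s
    induction s using Nat.strong_induction_on with
    | _ s ih =>
      intro a b hs
      have hN : (JB r 0 * X) a b = 0 := by
        rw [hl]
        split_ifs with h'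
        · exact ih (r - 1 - (a + 1) + b) (by omega) _ _ rfl
        · rfl
      have hN' : (X * JB p 0) a b = 0 :=
        hr X a b fun b' hb' => ih _ (by have := Fin.lt_def.mp hb'; omega) a b' rfl
      have hNN : (JB r 0 * X * JB p 0) a b = 0 := by
        refine hr _ a b fun b' hb' => ?_
        rw [hl]
        split_ifs with h'
        · exact ih (r - 1 - (a + 1) + b') (by have := Fin.lt_def.mp hb'; omega) _ _ rfl
        · rfl
      have e := congrFun (congrFun hX a) b
      simp only [Matrix.add_mul, Matrix.mul_add, Matrix.smul_mul, Matrix.mul_smul, Matrix.one_mul,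
        Matrix.mul_one, Matrix.add_apply, Matrix.smul_apply, hN, hN', hNN, smul_eq_mul, mul_zero,
        add_zero] at e
      have e' : (lam * mu - 1) * X a b = 0 := by linear_combination e
      exact (mul_eq_zero.mp e').resolve_left (sub_ne_zero.mpr h)
  rw [Submodule.mem_bot]
  ext a b
  exact key _ a b rfl

lemma mem_sandwichFixed_JB_iff (p r : ℕ) {lam mu : ℂ} (h : lam * mu = 1)
    (X : Matrix (Fin r) (Fin p) ℂ) :
    X ∈ sandwichFixed (JB r mu) (JB p lam) ↔
      Matrix.toLin' (JB r 0) ∘ₗ Matrix.toLin' X =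
        Matrix.toLin' X ∘ₗ Matrix.toLin' ((JB p lam)⁻¹ - mu • 1) := by
  have hu : IsUnit (JB p lam).det :=
    (Matrix.isUnit_iff_isUnit_det _).mp (isUnit_JB p (left_ne_zero_of_mul_eq_one h))
  rw [← Matrix.toLin'_mul, ← Matrix.toLin'_mul, Matrix.toLin'.injective.eq_iff,
    mem_sandwichFixed, JB_eq_smul_one_add r, Matrix.mul_sub, Matrix.mul_smul, Matrix.mul_one,
    eq_sub_iff_add_eq]
  have e : JB r 0 * X + mu • X = (mu • 1 + JB r 0) * X := by
    rw [Matrix.add_mul, Matrix.smul_mul, Matrix.one_mul, add_comm]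
  rw [e]
  constructor
  · intro h1
    rw [← h1, Matrix.mul_assoc _ (JB p lam), Matrix.mul_nonsing_inv _ hu, Matrix.mul_one, h1]
  · intro h1
    rw [h1, Matrix.mul_assoc, Matrix.nonsing_inv_mul _ hu, Matrix.mul_one]

/-- The rank-at-most-`k` solutions of `J_r(mu) X J_p(lam) = X` form a subspace of
known dimension. -/
lemma exists_submodule_sandwichFixed_JB (p r k : ℕ) (lam mu : ℂ) :
    ∃ L : Submodule ℂ (Matrix (Fin r) (Fin p) ℂ),
      (∀ X, X ∈ L ↔ X ∈ sandwichFixed (JB r mu) (JB p lam) ∧ X.rank ≤ k) ∧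
      Module.finrank ℂ L = if lam * mu = 1 then min k (min p r) else 0 := by
  by_cases h : lam * mu = 1
  swap
  · refine ⟨⊥, fun X => ?_, by simp [h]⟩
    rw [sandwichFixed_JB_eq_bot p r h, Submodule.mem_bot]
    constructor
    · rintro rfl
      simp
    · exact And.left
  obtain ⟨v, b, hb, hf⟩ := exists_cyclic_basis_inv_JB p h
  set f := Matrix.toLin' ((JB p lam)⁻¹ - mu • 1)
  set g := Matrix.toLin' (JB r 0)
  let ev : Matrix (Fin r) (Fin p) ℂ →ₗ[ℂ] (Fin r → ℂ) :=
    (LinearMap.applyₗ v) ∘ₗ (Matrix.toLin' : Matrix (Fin r) (Fin p) ℂ ≃ₗ[ℂ] _).toLinearMap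
  have hev : ∀ X, ev X = Matrix.toLin' X v := fun X => rfl
  have hrank : ∀ X ∈ sandwichFixed (JB r mu) (JB p lam), ∀ s, X.rank ≤ s ↔ (g ^ s) (ev X) = 0 :=
    fun X hX s => finrank_range_le_iff_of_intertwines f g v p b hb hf (Matrix.toLin' X)
      ((mem_sandwichFixed_JB_iff p r h X).mp hX) s
  let L := sandwichFixed (JB r mu) (JB p lam) ⊓ (LinearMap.ker (g ^ k)).comap ev
  have hL : ∀ X, X ∈ L ↔ X ∈ sandwichFixed (JB r mu) (JB p lam) ∧ X.rank ≤ k := by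
    intro X
    simp only [L, Submodule.mem_inf, Submodule.mem_comap, LinearMap.mem_ker]
    exact and_congr_right fun hX => (hrank X hX k).symm
  refine ⟨L, hL, ?_⟩
  rw [if_pos h]
  have hinj : Function.Injective (ev.domRestrict L) := by
    rw [← LinearMap.ker_eq_bot, LinearMap.ker_eq_bot']
    rintro ⟨X, hX⟩ hX0
    have := eq_zero_of_intertwines_of_apply_eq_zero f g v p b hb (Matrix.toLin' X)
      ((mem_sandwichFixed_JB_iff p r h X).mp ((hL X).mp hX).1) hX0
    exact Subtype.ext (by simpa using this)
  have hrange : LinearMap.range (ev.domRestrict L) = LinearMap.ker (g ^ (min k p)) := by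
    ext w
    rw [LinearMap.mem_ker]
    constructor
    · rintro ⟨⟨X, hX⟩, rfl⟩
      rw [hL] at hX
      refine (hrank X hX.1 _).mp (le_min hX.2 ?_)
      simpa using X.rank_le_card_width
    · intro hw
      have hge : ∀ s, min k p ≤ s → (g ^ s) w = 0 := by
        intro s hs
        obtain ⟨d, rfl⟩ := Nat.exists_eq_add_of_le' hs
        rw [pow_add, Module.End.mul_apply, hw, map_zero]
      obtain ⟨X, hX, hXv⟩ := exists_intertwiner_of_pow_apply_eq_zero f g v p b hb hf w
        (hge p (min_le_right _ _))
      have hX' : LinearMap.toMatrix' X ∈ sandwichFixed (JB r mu) (JB p lam) := by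
        rw [mem_sandwichFixed_JB_iff p r h, Matrix.toLin'_toMatrix']
        exact hX
      have hevX : ev (LinearMap.toMatrix' X) = w := by
        rw [hev, Matrix.toLin'_toMatrix', hXv]
      refine ⟨⟨LinearMap.toMatrix' X, (hL _).mpr ⟨hX', ?_⟩⟩, hevX⟩
      rw [hrank _ hX', hevX]
      exact hge k (min_le_left _ _)
  rw [← LinearMap.finrank_range_of_inj hinj, hrange, finrank_ker_toLin'_JB_zero_pow]
  omega

/-- The dimension of a subspace cut out blockwise by a direct sum decomposition. -/
lemma finrank_eq_sum_of_blocks {K V τ : Type*} [Field K] [AddCommGroup V] [Module K V]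
    [Fintype τ] {U : τ → Type*} [∀ t, AddCommGroup (U t)] [∀ t, Module K (U t)]
    [∀ t, FiniteDimensional K (U t)]
    (proj : ∀ t, V →ₗ[K] U t) (inc : ∀ t, U t →ₗ[K] V)
    (hself : ∀ t u, proj t (inc t u) = u) (hne : ∀ s t, s ≠ t → ∀ u, proj s (inc t u) = 0)
    (hsum : ∀ v, ∑ t, inc t (proj t v) = v)
    (S : Submodule K V) (L : ∀ t, Submodule K (U t)) (hS : ∀ v, v ∈ S ↔ ∀ t, proj t v ∈ L t) :
    Module.finrank K S = ∑ t, Module.finrank K (L t) := by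
  classical
  have hproj : ∀ (x : ∀ t, U t) s, proj s (∑ t, inc t (x t)) = x s := by
    intro x s
    rw [map_sum, Finset.sum_eq_single s (fun t _ ht => hne s t ht.symm _) (by simp), hself]
  let e : S ≃ₗ[K] ∀ t, L t :=
    { toFun := fun v t => ⟨proj t v, (hS v).mp v.2 t⟩
      map_add' := fun v w => by ext t; simp
      map_smul' := fun c v => by ext t; simp
      invFun := fun x => ⟨∑ t, inc t (x t), (hS _).mpr fun s => by
        rw [hproj fun t => (x t : U t)]; exact (x s).2⟩
      left_inv := fun v => Subtype.ext (hsum v)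
      right_inv := fun x => by
        ext s
        exact hproj (fun t => (x t : U t)) s }
  rw [e.finrank_eq, Module.finrank_pi_fintype]

/-- A matrix similar to a direct sum of matrices `J i` admits inclusions `E i` and
projections `E' i` splitting the space into blocks on which it acts by `J i`. -/
lemma exists_block_splitting {n N : ℕ} (p : Fin N → ℕ) (A P : Matrix (Fin n) (Fin n) ℂ)
    (J : ∀ i, Matrix (Fin (p i)) (Fin (p i)) ℂ) (e : ((i : Fin N) × Fin (p i)) ≃ Fin n)
    (hP : IsUnit P)
    (hA : A = P * (Matrix.reindex e e (Matrix.blockDiagonal' J)) * P⁻¹) :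
    ∃ (E : ∀ i, Matrix (Fin n) (Fin (p i)) ℂ) (E' : ∀ i, Matrix (Fin (p i)) (Fin n) ℂ),
      (∀ i, E' i * E i = 1) ∧ (∀ i j, i ≠ j → E' i * E j = 0) ∧ (∑ i, E i * E' i = 1) ∧
      (∀ i, A * E i = E i * J i) ∧ (∀ i, E' i * A = J i * E' i) := by
  have hdet : IsUnit P.det := (Matrix.isUnit_iff_isUnit_det _).mp hP
  let E : ∀ i, Matrix (Fin n) (Fin (p i)) ℂ := fun i => P.submatrix id fun a => e ⟨i, a⟩
  let E' : ∀ i, Matrix (Fin (p i)) (Fin n) ℂ := fun i => P⁻¹.submatrix (fun a => e ⟨i, a⟩) id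
  have hEE : ∀ i j, E' i * E j =
      (1 : Matrix (Fin n) (Fin n) ℂ).submatrix (fun a => e ⟨i, a⟩) (fun a => e ⟨j, a⟩) := by
    intro i j
    rw [← Matrix.nonsing_inv_mul _ hdet, Matrix.submatrix_mul _ _ _ id _ Function.bijective_id]
  have h1 : ∀ i, E' i * E i = 1 := by
    intro i
    rw [hEE]
    ext a b
    simp [Matrix.one_apply]
  have h2 : ∀ i j, i ≠ j → E' i * E j = 0 := by
    intro i j hij
    rw [hEE]
    ext a b
    simp [hij]
  have h3 : ∑ i, E i * E' i = 1 := by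
    rw [← Matrix.mul_nonsing_inv _ hdet]
    ext x y
    rw [Matrix.sum_apply, Matrix.mul_apply, ← e.sum_comp, Fintype.sum_sigma]
    rfl
  have h4 : ∀ i, A * E i = E i * J i := by
    intro i
    have hAP : A * P = P * Matrix.reindex e e (Matrix.blockDiagonal' J) := by
      rw [hA, Matrix.mul_assoc, Matrix.nonsing_inv_mul _ hdet, Matrix.mul_one]
    have hAE : A * E i = (A * P).submatrix id fun a => e ⟨i, a⟩ := rfl
    rw [hAE, hAP]
    ext x b
    rw [Matrix.submatrix_apply, Matrix.mul_apply, Matrix.mul_apply, ← e.sum_comp,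
      Fintype.sum_sigma, Finset.sum_eq_single i]
    · refine Finset.sum_congr rfl fun a _ => ?_
      simp [E]
    · intro j _ hj
      refine Finset.sum_eq_zero fun a _ => ?_
      simp [Matrix.blockDiagonal'_apply_ne _ _ _ hj]
    · simp
  refine ⟨E, E', h1, h2, h3, h4, fun i => ?_⟩
  calc E' i * A = E' i * A * ∑ j, E j * E' j := by rw [h3, Matrix.mul_one]
    _ = ∑ j, E' i * E j * (J j * E' j) := by
        rw [Matrix.mul_sum]
        refine Finset.sum_congr rfl fun j _ => ?_
        rw [Matrix.mul_assoc, ← Matrix.mul_assoc A, h4]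
        simp only [Matrix.mul_assoc]
    _ = J i * E' i := by
        rw [Finset.sum_eq_single i]
        · rw [h1, Matrix.one_mul]
        · intro j _ hj
          rw [h2 i j hj.symm, Matrix.zero_mul]
        · simp

/-- The trace pairing `(X, Y) ↦ tr (X Y)` as a bilinear form. -/
noncomputable def tracePairing (n : ℕ) : LinearMap.BilinForm ℂ (Matrix (Fin n) (Fin n) ℂ) :=
  (LinearMap.mul ℂ (Matrix (Fin n) (Fin n) ℂ)).compr₂ (Matrix.traceLinearMap (Fin n) ℂ ℂ)

lemma tracePairing_apply {n : ℕ} (X Y : Matrix (Fin n) (Fin n) ℂ) :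
    tracePairing n X Y = (X * Y).trace := rfl

lemma tracePairing_nondegenerate (n : ℕ) : (tracePairing n).Nondegenerate := by
  constructor
  · intro X h
    exact Matrix.ext_iff_trace_mul_right.mpr fun Y => by simpa [tracePairing_apply] using h Y
  · intro X h
    exact Matrix.ext_iff_trace_mul_left.mpr fun Y => by simpa [tracePairing_apply] using h Y

lemma annih_eq_orthogonal_span {n : ℕ} (S : Set (Matrix (Fin n) (Fin n) ℂ)) :
    annih S = ((tracePairing n).orthogonal (Submodule.span ℂ S) : Set _) := by
  ext C
  rw [SetLike.mem_coe, LinearMap.BilinForm.mem_orthogonal_iff]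
  constructor
  · intro h X hX
    induction hX using Submodule.span_induction with
    | mem X hX => rw [tracePairing_apply, Matrix.trace_mul_comm]; exact h X hX
    | zero => simp
    | add X Y _ _ h1 h2 => simp [h1, h2]
    | smul c X _ h1 => simp [h1]
  · intro h X hX
    rw [Matrix.trace_mul_comm]
    exact h X (Submodule.subset_span hX)

lemma finrank_span_annih {n : ℕ} (S : Set (Matrix (Fin n) (Fin n) ℂ)) :
    Module.finrank ℂ (Submodule.span ℂ (annih S)) =
      n * n - Module.finrank ℂ (Submodule.span ℂ S) := by
  rw [annih_eq_orthogonal_span, Submodule.span_eq,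
    LinearMap.BilinForm.finrank_orthogonal (tracePairing_nondegenerate n)]
  simp [Module.finrank_matrix]

lemma rdK_eq_finrank_annih_sub {n : ℕ} (k : ℕ) (S : Set (Matrix (Fin n) (Fin n) ℂ)) :
    rdK k S = Module.finrank ℂ (Submodule.span ℂ (annih S)) -
      Module.finrank ℂ (Submodule.span ℂ {C | C ∈ annih S ∧ C.rank ≤ k}) := by
  have h1 : Module.finrank ℂ (Submodule.span ℂ S) ≤ n * n :=
    (Submodule.finrank_le _).trans (by simp [Module.finrank_matrix])
  have h2 : Module.finrank ℂ (Submodule.span ℂ {C | C ∈ annih S ∧ C.rank ≤ k}) ≤ n * n :=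
    (Submodule.finrank_le _).trans (by simp [Module.finrank_matrix])
  rw [rdK, RefK, finrank_span_annih, finrank_span_annih]
  omega

lemma annih_range_sandwich_sub {n : ℕ} (A B : Matrix (Fin n) (Fin n) ℂ) :
    annih (Set.range fun T : Matrix (Fin n) (Fin n) ℂ => A * T * B - T) =
      (sandwichFixed B A : Set _) := by
  ext C
  have key : ∀ T : Matrix (Fin n) (Fin n) ℂ, (C * (A * T * B - T)).trace = 0 ↔
      (B * C * A * T).trace = (C * T).trace := by
    intro T
    rw [Matrix.mul_sub, Matrix.trace_sub, sub_eq_zero, ← Matrix.mul_assoc, Matrix.trace_mul_comm]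
    simp only [Matrix.mul_assoc]
  rw [SetLike.mem_coe, mem_sandwichFixed, Matrix.ext_iff_trace_mul_right]
  constructor
  · intro h T
    exact (key T).mp (h _ ⟨T, rfl⟩)
  · rintro h _ ⟨T, rfl⟩
    exact (key T).mpr (h T)

/-- Span dimension of the rank-at-most-`k` solutions of `B C A = C`, for `A` and `B` split
into Jordan blocks. -/
lemma finrank_span_sandwichFixed_rank_le {n N M : ℕ} (k : ℕ)
    (p : Fin N → ℕ) (r : Fin M → ℕ) (lam : Fin N → ℂ) (mu : Fin M → ℂ)
    (A B : Matrix (Fin n) (Fin n) ℂ)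
    (F : ∀ i, Matrix (Fin n) (Fin (p i)) ℂ) (F' : ∀ i, Matrix (Fin (p i)) (Fin n) ℂ)
    (hF : ∀ i, F' i * F i = 1) (hFne : ∀ i j, i ≠ j → F' i * F j = 0)
    (hFsum : ∑ i, F i * F' i = 1)
    (hAF : ∀ i, A * F i = F i * JB (p i) (lam i)) (hFA : ∀ i, F' i * A = JB (p i) (lam i) * F' i)
    (E : ∀ j, Matrix (Fin n) (Fin (r j)) ℂ) (E' : ∀ j, Matrix (Fin (r j)) (Fin n) ℂ)
    (hE : ∀ j, E' j * E j = 1) (hEne : ∀ i j, i ≠ j → E' i * E j = 0)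
    (hEsum : ∑ j, E j * E' j = 1)
    (hBE : ∀ j, B * E j = E j * JB (r j) (mu j)) (hEB : ∀ j, E' j * B = JB (r j) (mu j) * E' j) :
    Module.finrank ℂ (Submodule.span ℂ {C | C ∈ sandwichFixed B A ∧ C.rank ≤ k}) =
      ∑ i, ∑ j, if lam i * mu j = 1 then min k (min (p i) (r j)) else 0 := by
  choose L hL hLrank using fun t : Fin N × Fin M =>
    exists_submodule_sandwichFixed_JB (p t.1) (r t.2) k (lam t.1) (mu t.2)
  let proj : ∀ t : Fin N × Fin M,
      Matrix (Fin n) (Fin n) ℂ →ₗ[ℂ] Matrix (Fin (r t.2)) (Fin (p t.1)) ℂ := fun t =>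
    { toFun := fun C => E' t.2 * C * F t.1
      map_add' := fun C D => by rw [Matrix.mul_add, Matrix.add_mul]
      map_smul' := fun c C => by rw [Matrix.mul_smul, Matrix.smul_mul, RingHom.id_apply] }
  let inc : ∀ t : Fin N × Fin M,
      Matrix (Fin (r t.2)) (Fin (p t.1)) ℂ →ₗ[ℂ] Matrix (Fin n) (Fin n) ℂ := fun t =>
    { toFun := fun X => E t.2 * X * F' t.1
      map_add' := fun C D => by rw [Matrix.mul_add, Matrix.add_mul]
      map_smul' := fun c C => by rw [Matrix.mul_smul, Matrix.smul_mul, RingHom.id_apply] }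
  have hproj : ∀ t C, proj t C = E' t.2 * C * F t.1 := fun t C => rfl
  have hinc : ∀ t X, inc t X = E t.2 * X * F' t.1 := fun t X => rfl
  have hcomp : ∀ s t X, proj s (inc t X) = (E' s.2 * E t.2) * X * (F' t.1 * F s.1) := by
    intro s t X
    rw [hproj, hinc]
    simp only [Matrix.mul_assoc]
  have hself : ∀ t X, proj t (inc t X) = X := by
    intro t X
    rw [hcomp, hE, hF, Matrix.one_mul, Matrix.mul_one]
  have hne : ∀ s t, s ≠ t → ∀ X, proj s (inc t X) = 0 := by
    intro s t hst X
    rw [hcomp]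
    by_cases h : s.2 = t.2
    · rw [hFne t.1 s.1 fun h' => hst (Prod.ext h'.symm h), Matrix.mul_zero]
    · rw [hEne _ _ h, Matrix.zero_mul, Matrix.zero_mul]
  have hsum : ∀ C, ∑ t, inc t (proj t C) = C := by
    intro C
    have e : ∀ t : Fin N × Fin M, inc t (proj t C) =
        (E t.2 * E' t.2) * (C * (F t.1 * F' t.1)) := by
      intro t
      rw [hproj, hinc]
      simp only [Matrix.mul_assoc]
    calc ∑ t, inc t (proj t C) = ∑ i, ∑ j, (E j * E' j) * (C * (F i * F' i)) := by
          simp only [e]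
          exact Fintype.sum_prod_type fun t : Fin N × Fin M =>
            (E t.2 * E' t.2) * (C * (F t.1 * F' t.1))
      _ = ∑ i, C * (F i * F' i) :=
          Finset.sum_congr rfl fun i _ => by rw [← Matrix.sum_mul, hEsum, Matrix.one_mul]
      _ = C := by rw [← Matrix.mul_sum, hFsum, Matrix.mul_one]
  let S : Submodule ℂ (Matrix (Fin n) (Fin n) ℂ) := ⨅ t, (L t).comap (proj t)
  have hS : ∀ C, C ∈ S ↔ ∀ t, proj t C ∈ L t := by
    intro C
    simp [S, Submodule.mem_iInf]
  have hspan : Submodule.span ℂ {C | C ∈ sandwichFixed B A ∧ C.rank ≤ k} = S := by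
    apply le_antisymm
    · rw [Submodule.span_le]
      rintro C ⟨hC, hCk⟩
      rw [SetLike.mem_coe, hS]
      intro t
      rw [hL, hproj, mem_sandwichFixed]
      constructor
      · calc _ = (JB (r t.2) (mu t.2) * E' t.2) * C * (F t.1 * JB (p t.1) (lam t.1)) := by
              simp only [Matrix.mul_assoc]
          _ = E' t.2 * (B * C * A) * F t.1 := by
              rw [← hEB, ← hAF]
              simp only [Matrix.mul_assoc]
          _ = _ := by rw [mem_sandwichFixed.mp hC]
      · exact ((Matrix.rank_mul_le_left _ _).trans (Matrix.rank_mul_le_right _ _)).trans hCk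
    · intro C hC
      rw [hS] at hC
      rw [← hsum C]
      refine Submodule.sum_mem _ fun t _ => Submodule.subset_span ?_
      obtain ⟨h1, h2⟩ := (hL t _).mp (hC t)
      rw [hinc]
      refine ⟨?_, ((Matrix.rank_mul_le_left _ _).trans (Matrix.rank_mul_le_right _ _)).trans h2⟩
      rw [mem_sandwichFixed] at h1 ⊢
      calc _ = (B * E t.2) * proj t C * (F' t.1 * A) := by simp only [Matrix.mul_assoc]
        _ = E t.2 * (JB (r t.2) (mu t.2) * proj t C * JB (p t.1) (lam t.1)) * F' t.1 := by
            rw [hBE, hFA]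
            simp only [Matrix.mul_assoc]
        _ = _ := by rw [h1]
  rw [hspan, finrank_eq_sum_of_blocks proj inc hself hne hsum S L hS, Fintype.sum_prod_type]
  exact Finset.sum_congr rfl fun i _ => Finset.sum_congr rfl fun j _ => hLrank (i, j)

open scoped Classical in
/-- `rd_k(im Δ)` for `Δ(T) = ATB − T`, where `A ≅ ⊕ᵢ J_{pᵢ}(λᵢ)`
and `B ≅ ⊕ⱼ J_{rⱼ}(μⱼ)`. -/
theorem rdk_image_elementary_ATB_sub_T (n k N M : ℕ) (hn : 0 < n) (hk : 0 < k)
    (p : Fin N → ℕ) (r : Fin M → ℕ) (lam : Fin N → ℂ) (mu : Fin M → ℂ)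
    (hp : ∑ i, p i = n) (hr : ∑ j, r j = n)
    (A B : Matrix (Fin n) (Fin n) ℂ)
    (eA : ((i : Fin N) × Fin (p i)) ≃ Fin n)
    (eB : ((j : Fin M) × Fin (r j)) ≃ Fin n)
    (hA : ∃ P : Matrix (Fin n) (Fin n) ℂ, IsUnit P ∧
      A = P * (Matrix.reindex eA eA (Matrix.blockDiagonal' fun i => JB (p i) (lam i))) * P⁻¹)
    (hB : ∃ Q : Matrix (Fin n) (Fin n) ℂ, IsUnit Q ∧
      B = Q * (Matrix.reindex eB eB (Matrix.blockDiagonal' fun j => JB (r j) (mu j))) * Q⁻¹) :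
    rdK k (Set.range fun T : Matrix (Fin n) (Fin n) ℂ => A * T * B - T) =
      ∑ i : Fin N, ∑ j : Fin M,
        if lam i ≠ 0 ∧ mu j ≠ 0 ∧ lam i = (mu j)⁻¹ ∧ k < min (p i) (r j)
          then min (p i) (r j) - k else 0 := by
  obtain ⟨P, hP, hA⟩ := hA
  obtain ⟨Q, hQ, hB⟩ := hB
  obtain ⟨F, F', hF, hFne, hFsum, hAF, hFA⟩ := exists_block_splitting p A P _ eA hP hA
  obtain ⟨E, E', hE, hEne, hEsum, hBE, hEB⟩ := exists_block_splitting r B Q _ eB hQ hB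
  have key := fun l => finrank_span_sandwichFixed_rank_le l p r lam mu A B F F' hF hFne hFsum
    hAF hFA E E' hE hEne hEsum hBE hEB
  have htop : {C | C ∈ sandwichFixed B A ∧ C.rank ≤ n} = (sandwichFixed B A : Set _) := by
    ext C
    exact and_iff_left (by simpa using C.rank_le_card_width)
  have hple : ∀ i, p i ≤ n := fun i => hp ▸ Finset.single_le_sum (f := p) (by simp) (by simp)
  rw [rdK_eq_finrank_annih_sub, annih_range_sandwich_sub]
  change _ - Module.finrank ℂ
    (Submodule.span ℂ {C | C ∈ sandwichFixed B A ∧ C.rank ≤ k}) = _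
  rw [key k, ← htop, key n, Nat.sub_eq_iff_eq_add, ← Finset.sum_add_distrib]
  · refine Finset.sum_congr rfl fun i _ => ?_
    rw [← Finset.sum_add_distrib]
    refine Finset.sum_congr rfl fun j _ => ?_
    have hi := hple i
    by_cases h : lam i * mu j = 1
    · have h1 := left_ne_zero_of_mul_eq_one h
      have h2 := right_ne_zero_of_mul_eq_one h
      have h3 : lam i = (mu j)⁻¹ := eq_inv_of_mul_eq_one_left h
      rw [if_pos h, if_pos h]
      by_cases hlt : k < min (p i) (r j)
      · rw [if_pos ⟨h1, h2, h3, hlt⟩]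
        omega
      · rw [if_neg fun h' => hlt h'.2.2.2]
        omega
    · rw [if_neg h, if_neg h, if_neg]
      rintro ⟨-, h2, h3, -⟩
      exact h (by rw [h3, inv_mul_cancel₀ h2])
  · refine Finset.sum_le_sum fun i _ => Finset.sum_le_sum fun j _ => ?_
    have hi := hple i
    split_ifs <;> omega
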